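/- arXiv:1808.03197 — 2 statements merged into one kernel-verified Lean document; each statement's English description precedes it below -/
import Mathlib

section
/- Let v_n = [n³+n²; 2n², 1, …, 1] with 2n³ players of weight 1, and let w be the normalized weight vector w = (2n², 1, …, 1)/(2n³+2n²). Then for n ≥ 11, ‖BZI(v_n) − w‖_∞ ≥ 1 − 2/n and ‖BZI(v_n) − w‖₁ ≥ 2 − 4/n. -/
/-- Number of `i`-swings in the weighted game with quota `q`, weight function `w`,
and player set `P`. -/
def swingCount (q : ℕ) (w : ℕ → ℕ) (P : Finset ℕ) (i : ℕ) : ℕ :=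
  (((P.erase i).powerset).filter
    (fun S => (∑ j ∈ S, w j) < q ∧ q ≤ (∑ j ∈ S, w j) + w i)).card

lemma aux_wt_sum (n : ℕ) (S : Finset ℕ) (h : 0 ∉ S) :
    ∑ j ∈ S, (if j = 0 then 2 * n ^ 2 else 1) = S.card := by
  rw [Finset.card_eq_sum_ones]
  apply Finset.sum_congr rfl
  intro j hj
  have : j ≠ 0 := by rintro rfl; exact h hj
  simp [this]

lemma aux_zero (n : ℕ) (hn : 11 ≤ n) :
    ∑ k ∈ Finset.Ico (n ^ 3) (n ^ 3 + n), (2 * n ^ 3).choose k ≤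
    swingCount (n ^ 3 + n ^ 2) (fun i => if i = 0 then 2 * n ^ 2 else 1)
      (Finset.range (2 * n ^ 3 + 1)) 0 := by
  have hc : ((Finset.range (2 * n ^ 3 + 1)).erase 0).card = 2 * n ^ 3 := by
    rw [Finset.card_erase_of_mem (by simp)]; simp
  unfold swingCount
  set A := (Finset.range (2 * n ^ 3 + 1)).erase 0 with hA
  have hnn : n ≤ n ^ 2 := by nlinarith
  calc ∑ k ∈ Finset.Ico (n ^ 3) (n ^ 3 + n), (2 * n ^ 3).choose k
      = ∑ k ∈ Finset.Ico (n ^ 3) (n ^ 3 + n), (Finset.powersetCard k A).card := by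
        simp [Finset.card_powersetCard, hc]
    _ = ((Finset.Ico (n ^ 3) (n ^ 3 + n)).biUnion (fun k => Finset.powersetCard k A)).card := by
        rw [Finset.card_biUnion]
        intro x _ y _ hxy
        exact Finset.pairwise_disjoint_powersetCard A hxy
    _ ≤ _ := by
        apply Finset.card_le_card
        intro S hS
        simp only [Finset.mem_biUnion, Finset.mem_Ico, Finset.mem_powersetCard] at hS
        obtain ⟨k, ⟨h1, h2⟩, h3, h4⟩ := hS
        have h0 : 0 ∉ S := fun h => by have := h3 h; simp [hA] at this
        simp only [Finset.mem_filter, Finset.mem_powerset]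
        refine ⟨h3, ?_⟩
        rw [aux_wt_sum n S h0, h4]
        simp only [if_true]
        omega

lemma aux_pos (n : ℕ) (hn : 11 ≤ n) (i : ℕ) (hi : i ≠ 0) (hi2 : i < 2 * n ^ 3 + 1) :
    swingCount (n ^ 3 + n ^ 2) (fun i => if i = 0 then 2 * n ^ 2 else 1)
      (Finset.range (2 * n ^ 3 + 1)) i ≤ (2 * n ^ 3).choose (n ^ 3 + n ^ 2) := by
  have h32 : n ^ 2 + 1 ≤ n ^ 3 := by nlinarith [pow_pos (by omega : 0 < n) 2]
  set A := ((Finset.range (2 * n ^ 3 + 1)).erase i).erase 0 with hA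
  have hc : A.card = 2 * n ^ 3 - 1 := by
    rw [hA, Finset.card_erase_of_mem (by simp [hi.symm]), Finset.card_erase_of_mem (by simpa using hi2)]
    simp
  have key : swingCount (n ^ 3 + n ^ 2) (fun i => if i = 0 then 2 * n ^ 2 else 1)
      (Finset.range (2 * n ^ 3 + 1)) i ≤
      (Finset.powersetCard (n ^ 3 + n ^ 2 - 1) A ∪
        (Finset.powersetCard (n ^ 3 - n ^ 2 - 1) A).image (insert 0)).card := by
    unfold swingCount
    apply Finset.card_le_card
    intro S hS
    simp only [Finset.mem_filter, Finset.mem_powerset, hi, if_false] at hS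
    obtain ⟨h1, h2, h3⟩ := hS
    simp only [Finset.mem_union, Finset.mem_image, Finset.mem_powersetCard]
    by_cases h0 : 0 ∈ S
    · right
      refine ⟨S.erase 0, ⟨Finset.erase_subset_erase _ h1, ?_⟩, Finset.insert_erase h0⟩
      rw [← Finset.add_sum_erase S _ h0, aux_wt_sum n _ (Finset.notMem_erase 0 S)] at h2 h3
      simp only [if_true] at h2 h3
      omega
    · left
      rw [aux_wt_sum n S h0] at h2 h3
      refine ⟨fun x hx => ?_, by omega⟩
      rw [hA, Finset.mem_erase]
      exact ⟨fun h => h0 (h ▸ hx), h1 hx⟩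
  refine key.trans ((Finset.card_union_le _ _).trans ?_)
  refine (Nat.add_le_add_left Finset.card_image_le _).trans ?_
  rw [Finset.card_powersetCard, Finset.card_powersetCard, hc]
  obtain ⟨a, ha⟩ : ∃ a, 2 * n ^ 3 = a + 1 := ⟨2 * n ^ 3 - 1, by omega⟩
  obtain ⟨b, hb⟩ : ∃ b, n ^ 3 + n ^ 2 = b + 1 := ⟨n ^ 3 + n ^ 2 - 1, by omega⟩
  have e : (2 * n ^ 3 - 1).choose (n ^ 3 - n ^ 2 - 1) = a.choose (b + 1) := by
    rw [ha, Nat.add_sub_cancel]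
    apply Nat.choose_symm_of_eq_add
    omega
  rw [e, hb, ha, Nat.choose_succ_succ]
  simp

lemma aux_step (M D k : ℕ) (hk : k < M) (hD : M + k + 1 ≤ D) :
    ((2 * M).choose (M + (k + 1)) : ℝ) * Real.exp (((k + 1 : ℕ) : ℝ) ^ 2 / D) ≤
      ((2 * M).choose (M + k) : ℝ) * Real.exp ((k : ℝ) ^ 2 / D) := by
  have h := Nat.choose_succ_right_eq (2 * M) (M + k)
  have h' : ((2 * M).choose (M + (k + 1)) : ℝ) * (M + k + 1) =
      (2 * M).choose (M + k) * (M - k) := by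
    have e : 2 * M - (M + k) = M - k := by omega
    rw [e] at h
    have := congrArg (Nat.cast : ℕ → ℝ) h
    push_cast [Nat.cast_sub hk.le] at this
    rw [← add_assoc]
    linarith
  have hp : (0 : ℝ) < M + k + 1 := by positivity
  have hDr : (M : ℝ) + k + 1 ≤ D := by exact_mod_cast hD
  have hDp : (0 : ℝ) < D := lt_of_lt_of_le hp hDr
  have hr : ((M : ℝ) - k) / (M + k + 1) ≤ Real.exp (-((2 * k + 1) / D)) := by
    have h1 : ((M : ℝ) - k) / (M + k + 1) = 1 - (2 * k + 1) / (M + k + 1) := by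
      field_simp; ring
    have h2 : ((2 : ℝ) * k + 1) / D ≤ (2 * k + 1) / (M + k + 1) := by gcongr
    have h3 := Real.add_one_le_exp (-(((2 : ℝ) * k + 1) / D))
    linarith
  have h2 : ((2 * M).choose (M + (k + 1)) : ℝ) =
      (2 * M).choose (M + k) * (((M : ℝ) - k) / (M + k + 1)) := by
    field_simp; linarith
  have h3 : Real.exp ((k : ℝ) ^ 2 / D) =
      Real.exp (-((2 * k + 1) / D)) * Real.exp (((k + 1 : ℕ) : ℝ) ^ 2 / D) := by
    rw [← Real.exp_add]; congr 1; push_cast; field_simp; ring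
  rw [h2, h3, mul_assoc]
  gcongr

lemma aux_anti (M t s : ℕ) (hs : s ≤ M) (j k : ℕ) (hjk : j ≤ k) (hks : k ≤ s) (ht : t = M + s) :
    ((2 * M).choose (M + k) : ℝ) * Real.exp ((k : ℝ) ^ 2 / t) ≤
      ((2 * M).choose (M + j) : ℝ) * Real.exp ((j : ℝ) ^ 2 / t) := by
  induction k, hjk using Nat.le_induction with
  | base => exact le_rfl
  | succ k hk ih => exact (aux_step M t k (by omega) (by omega)).trans (ih (by omega))

lemma aux_pow (n : ℕ) (hn : 11 ≤ n) : 2 * (n : ℝ) ^ 3 ≤ Real.exp ((n : ℝ) - 1) := by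
  induction n, hn using Nat.le_induction with
  | base =>
    have h : Real.exp (((11 : ℕ) : ℝ) - 1) = Real.exp 1 ^ 10 := by
      rw [← Real.exp_nat_mul]; norm_num
    rw [h]
    have : (2.5 : ℝ) ^ 10 ≤ Real.exp 1 ^ 10 := by
      gcongr
      linarith [Real.exp_one_gt_d9]
    refine le_trans ?_ this
    norm_num
  | succ n hn ih =>
    have h : Real.exp (((n + 1 : ℕ) : ℝ) - 1) = Real.exp ((n : ℝ) - 1) * Real.exp 1 := by
      rw [← Real.exp_add]; push_cast; congr 1; ring
    rw [h]
    have h2 : (2 : ℝ) ≤ Real.exp 1 := by linarith [Real.exp_one_gt_d9]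
    have hn' : (11 : ℝ) ≤ n := by exact_mod_cast hn
    have h3 : 2 * ((n + 1 : ℕ) : ℝ) ^ 3 ≤ 2 * (n : ℝ) ^ 3 * 2 := by
      push_cast
      nlinarith [mul_nonneg (by linarith : (0:ℝ) ≤ n - 11) (sq_nonneg (n : ℝ)),
        mul_nonneg (by linarith : (0:ℝ) ≤ n - 11) (by linarith : (0:ℝ) ≤ n)]
    refine h3.trans ?_
    gcongr

lemma aux_main (n : ℕ) (hn : 11 ≤ n) :
    2 * (n : ℝ) ^ 4 * ((2 * n ^ 3).choose (n ^ 3 + n ^ 2) : ℝ) ≤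
      swingCount (n ^ 3 + n ^ 2) (fun i => if i = 0 then 2 * n ^ 2 else 1)
      (Finset.range (2 * n ^ 3 + 1)) 0 := by
  have h32 : n ^ 2 ≤ n ^ 3 := by nlinarith [pow_pos (by omega : 0 < n) 2]
  have hnn : n ≤ n ^ 2 := by nlinarith
  have hn0 : (0 : ℝ) < n := by exact_mod_cast (by omega : 0 < n)
  have A := aux_anti (n ^ 3) _ (n ^ 2) h32 n (n ^ 2) hnn le_rfl rfl
  have B : ∀ k ∈ Finset.Ico (n ^ 3) (n ^ 3 + n),
      ((2 * n ^ 3).choose (n ^ 3 + n) : ℝ) ≤ (2 * n ^ 3).choose k := by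
    intro k hk
    rw [Finset.mem_Ico] at hk
    obtain ⟨j, rfl⟩ := Nat.exists_eq_add_of_le hk.1
    have hj : j ≤ n := by omega
    have := aux_anti (n ^ 3) _ (n ^ 2) h32 j n hj hnn rfl
    have h2 : Real.exp ((j : ℝ) ^ 2 / (n ^ 3 + n ^ 2 : ℕ)) ≤
        Real.exp ((n : ℝ) ^ 2 / (n ^ 3 + n ^ 2 : ℕ)) := by gcongr
    have h3 := Real.exp_pos ((n : ℝ) ^ 2 / (n ^ 3 + n ^ 2 : ℕ))
    refine le_of_mul_le_mul_right (this.trans ?_) h3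
    gcongr
  have C : (n : ℝ) * (2 * n ^ 3).choose (n ^ 3 + n) ≤
      ∑ k ∈ Finset.Ico (n ^ 3) (n ^ 3 + n), ((2 * n ^ 3).choose k : ℝ) := by
    have := Finset.card_nsmul_le_sum _ _ _ B
    simpa using this
  have D : (∑ k ∈ Finset.Ico (n ^ 3) (n ^ 3 + n), ((2 * n ^ 3).choose k : ℝ)) ≤
      swingCount (n ^ 3 + n ^ 2) (fun i => if i = 0 then 2 * n ^ 2 else 1)
      (Finset.range (2 * n ^ 3 + 1)) 0 := by exact_mod_cast aux_zero n hn
  refine le_trans ?_ (C.trans D)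
  have E : Real.exp (((n ^ 2 : ℕ) : ℝ) ^ 2 / (n ^ 3 + n ^ 2 : ℕ)) =
      Real.exp ((n : ℝ) - 1) * Real.exp ((n : ℝ) ^ 2 / (n ^ 3 + n ^ 2 : ℕ)) := by
    rw [← Real.exp_add]; congr 1; push_cast; field_simp; ring
  rw [E, ← mul_assoc] at A
  have F := le_of_mul_le_mul_right A (Real.exp_pos _)
  have G := aux_pow n hn
  calc 2 * (n : ℝ) ^ 4 * ((2 * n ^ 3).choose (n ^ 3 + n ^ 2) : ℝ)
      = n * (((2 * n ^ 3).choose (n ^ 3 + n ^ 2) : ℝ) * (2 * (n : ℝ) ^ 3)) := by ring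
    _ ≤ n * (((2 * n ^ 3).choose (n ^ 3 + n ^ 2) : ℝ) * Real.exp ((n : ℝ) - 1)) := by gcongr
    _ ≤ _ := by gcongr

theorem stmt15 (n : ℕ) (hn : 11 ≤ n)
    (wt : ℕ → ℕ) (hwt : wt = fun i => if i = 0 then 2 * n ^ 2 else 1)
    (P : Finset ℕ) (hP : P = Finset.range (2 * n ^ 3 + 1))
    (BZI : ℕ → ℝ)
    (hBZI : BZI = fun i => (swingCount (n ^ 3 + n ^ 2) wt P i : ℝ) /
      (∑ j ∈ P, (swingCount (n ^ 3 + n ^ 2) wt P j : ℝ)))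
    (w : ℕ → ℝ) (hw : w = fun i => (wt i : ℝ) / (2 * (n : ℝ) ^ 3 + 2 * (n : ℝ) ^ 2)) :
    (∃ i ∈ P, 1 - 2 / (n : ℝ) ≤ |BZI i - w i|) ∧
      2 - 4 / (n : ℝ) ≤ ∑ i ∈ P, |BZI i - w i| := by
  have hn' : (11 : ℝ) ≤ n := by exact_mod_cast hn
  have hn0 : (0 : ℝ) < n := by linarith
  have hmain := aux_main n hn
  have hpos := aux_pos n hn
  rw [← hwt, ← hP] at hmain
  rw [← hwt, ← hP] at hpos
  have h0P : 0 ∈ P := by simp [hP]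
  have hpos' : ∀ j ∈ P.erase 0, (swingCount (n ^ 3 + n ^ 2) wt P j : ℝ) ≤
      ((2 * n ^ 3).choose (n ^ 3 + n ^ 2) : ℝ) := fun j hj => by
    rw [Finset.mem_erase, hP, Finset.mem_range] at hj
    exact Nat.cast_le.mpr (hpos j hj.1 hj.2)
  have hcpos : 0 < ((2 * n ^ 3).choose (n ^ 3 + n ^ 2) : ℝ) := by
    have : n ^ 2 ≤ n ^ 3 := by nlinarith [pow_pos (by omega : 0 < n) 2]
    exact Nat.cast_pos.mpr (Nat.choose_pos (by omega))
  clear hpos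
  obtain ⟨s, hs⟩ : ∃ s : ℕ → ℝ, s = fun j => (swingCount (n ^ 3 + n ^ 2) wt P j : ℝ) := ⟨_, rfl⟩
  have hsn : ∀ j, 0 ≤ s j := fun j => by rw [hs]; exact Nat.cast_nonneg _
  have hBs : BZI = fun i => s i / ∑ j ∈ P, s j := by rw [hBZI, hs]
  have hm : 2 * (n : ℝ) ^ 4 * ((2 * n ^ 3).choose (n ^ 3 + n ^ 2) : ℝ) ≤ s 0 := by
    rw [hs]; exact hmain
  have hps : ∀ j ∈ P.erase 0, s j ≤ ((2 * n ^ 3).choose (n ^ 3 + n ^ 2) : ℝ) := by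
    rw [hs]; exact hpos'
  clear hmain hpos' hBZI hs
  generalize ((2 * n ^ 3).choose (n ^ 3 + n ^ 2) : ℝ) = c at hcpos hm hps
  have hcard : ((P.erase 0).card : ℝ) = 2 * (n : ℝ) ^ 3 := by
    rw [Finset.card_erase_of_mem h0P, hP]; simp
  have hrest : ∑ j ∈ P.erase 0, s j ≤ 2 * (n : ℝ) ^ 3 * c := by
    have := Finset.sum_le_card_nsmul (P.erase 0) s c hps
    rwa [nsmul_eq_mul, hcard] at this
  have hrest0 : 0 ≤ ∑ j ∈ P.erase 0, s j := Finset.sum_nonneg (fun j _ => hsn j)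
  have hsplit : s 0 + ∑ j ∈ P.erase 0, s j = ∑ j ∈ P, s j := Finset.add_sum_erase P s h0P
  have hs0 : 0 < s 0 := lt_of_lt_of_le (by positivity) hm
  have hT : 0 < ∑ j ∈ P, s j := by linarith
  have hB0 : 1 - 1 / (n : ℝ) ≤ BZI 0 := by
    have e : BZI 0 = s 0 / ∑ j ∈ P, s j := by rw [hBs]
    rw [e, le_div_iff₀ hT, ← hsplit]
    have : (∑ j ∈ P.erase 0, s j) ≤ 1 / n * s 0 := by
      rw [div_mul_eq_mul_div, one_mul, le_div_iff₀ hn0]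
      nlinarith
    have h1 : 0 ≤ 1 / (n : ℝ) * (∑ j ∈ P.erase 0, s j) := by positivity
    nlinarith
  have hw0 : w 0 ≤ 1 / (n : ℝ) := by
    rw [hw, hwt]
    simp only [if_true]
    push_cast
    rw [div_le_div_iff₀ (by positivity) hn0]
    nlinarith [sq_nonneg (n : ℝ)]
  have hfirst : 1 - 2 / (n : ℝ) ≤ BZI 0 - w 0 := by
    have : 2 / (n : ℝ) = 1 / n + 1 / n := by ring
    linarith
  refine ⟨⟨0, h0P, hfirst.trans (le_abs_self _)⟩, ?_⟩
  have hBsum : ∑ i ∈ P, BZI i = 1 := by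
    rw [hBs]
    rw [← Finset.sum_div]
    exact div_self hT.ne'
  have hwsum : ∑ i ∈ P, w i = 1 := by
    rw [hw]
    rw [← Finset.sum_div, ← Finset.add_sum_erase P _ h0P]
    have : ∑ x ∈ P.erase 0, (wt x : ℝ) = 2 * (n : ℝ) ^ 3 := by
      rw [← hcard, hwt, ← Nat.cast_sum, aux_wt_sum n _ (Finset.notMem_erase 0 P)]
    rw [this, hwt]
    simp only [if_true]
    push_cast
    rw [add_comm]
    exact div_self (by positivity)
  have hsum : (BZI 0 - w 0) + ∑ i ∈ P.erase 0, (BZI i - w i) = 0 := by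
    rw [Finset.add_sum_erase P (fun i => BZI i - w i) h0P, Finset.sum_sub_distrib, hBsum, hwsum,
      sub_self]
  rw [← Finset.add_sum_erase P _ h0P]
  have h1 := Finset.abs_sum_le_sum_abs (fun i => BZI i - w i) (P.erase 0)
  have h2 := neg_abs_le (∑ i ∈ P.erase 0, (BZI i - w i))
  have h3 := le_abs_self (BZI 0 - w 0)
  have h4 : 4 / (n : ℝ) = 2 * (2 / n) := by ring
  linarith
end

section
/- Let v_n be the weighted game with 2n+1 players of weight 2n², 2n³ players of weight 1, and quota 3n³+n², and let w be the normalized weight vector (each large player has weight 2n²/(6n³+2n²), each small player 1/(6n³+2n²)). Then for n ≥ 11, ‖BZI(v_n) − w‖₁ ≥ 1/5. -/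
open Finset in
lemma tail_bound (A : Finset ℕ) (t d : ℝ) (ht : 0 ≤ t) :
    (((A.powerset).filter (fun B => d ≤ |2 * (B.card : ℝ) - A.card|)).card : ℝ)
      ≤ 2 * 2 ^ A.card * Real.exp (A.card * t ^ 2 / 2 - t * d) := by
  have h1 : ∀ s : ℝ, ∑ B ∈ A.powerset, Real.exp (s * (2 * (B.card : ℝ) - A.card))
      = (2 * Real.cosh s) ^ A.card := by
    intro s
    have := Finset.sum_pow_mul_eq_add_pow (Real.exp s) (Real.exp (-s)) A
    rw [Real.cosh_eq, mul_div_cancel₀ _ (by norm_num : (2 : ℝ) ≠ 0), ← this]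
    apply Finset.sum_congr rfl
    intro B hB
    have hc := Finset.card_le_card (Finset.mem_powerset.1 hB)
    rw [← Real.exp_nat_mul, ← Real.exp_nat_mul, ← Real.exp_add]
    congr 1
    push_cast [Nat.cast_sub hc]
    ring
  have h2 : (((A.powerset).filter (fun B => d ≤ |2 * (B.card : ℝ) - A.card|)).card : ℝ)
      * Real.exp (t * d) ≤ 2 * (2 * Real.cosh t) ^ A.card := by
    calc _ = ∑ B ∈ (A.powerset).filter (fun B => d ≤ |2 * (B.card : ℝ) - A.card|),
            Real.exp (t * d) := by rw [Finset.sum_const, nsmul_eq_mul]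
      _ ≤ ∑ B ∈ (A.powerset).filter (fun B => d ≤ |2 * (B.card : ℝ) - A.card|),
            (Real.exp (t * (2 * (B.card : ℝ) - A.card))
              + Real.exp ((-t) * (2 * (B.card : ℝ) - A.card))) := by
          apply Finset.sum_le_sum
          intro B hB
          have hB := (Finset.mem_filter.1 hB).2
          rcases le_abs.1 hB with h | h
          · have : Real.exp (t * d) ≤ Real.exp (t * (2 * (B.card : ℝ) - A.card)) :=
              Real.exp_le_exp.2 (mul_le_mul_of_nonneg_left h ht)
            linarith [Real.exp_pos ((-t) * (2 * (B.card : ℝ) - A.card))]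
          · have : Real.exp (t * d) ≤ Real.exp ((-t) * (2 * (B.card : ℝ) - A.card)) :=
              Real.exp_le_exp.2 (by nlinarith [mul_le_mul_of_nonneg_left h ht])
            linarith [Real.exp_pos (t * (2 * (B.card : ℝ) - A.card))]
      _ ≤ ∑ B ∈ A.powerset,
            (Real.exp (t * (2 * (B.card : ℝ) - A.card))
              + Real.exp ((-t) * (2 * (B.card : ℝ) - A.card))) := by
          apply Finset.sum_le_sum_of_subset_of_nonneg (Finset.filter_subset _ _)
          intros; positivity
      _ = 2 * (2 * Real.cosh t) ^ A.card := by
          rw [Finset.sum_add_distrib, h1, h1, Real.cosh_neg]; ring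
  have h3 : (2 * Real.cosh t) ^ A.card ≤ 2 ^ A.card * Real.exp (A.card * t ^ 2 / 2) := by
    have : Real.exp (A.card * t ^ 2 / 2) = Real.exp (t ^ 2 / 2) ^ A.card := by
      rw [← Real.exp_nat_mul]; congr 1; ring
    rw [this, ← mul_pow]
    apply pow_le_pow_left₀
    · have := Real.cosh_pos t; positivity
    · linarith [Real.cosh_le_exp_half_sq t]
  rw [Real.exp_sub, ← mul_div_assoc, le_div_iff₀ (Real.exp_pos _)]
  linarith

lemma num_bound (n : ℕ) (hn : 11 ≤ n) : 18 * (n : ℝ) ^ 3 ≤ Real.exp n := by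
  have h : 18 * (n : ℝ) ^ 3 ≤ (2.7 : ℝ) ^ n := by
    induction n, hn using Nat.le_induction with
    | base => norm_num
    | succ k hk ih =>
      have hk' : (11 : ℝ) ≤ k := by exact_mod_cast hk
      rw [pow_succ (2.7 : ℝ) k]
      push_cast
      have : ((k : ℝ) + 1) ^ 3 ≤ 2.7 * (k : ℝ) ^ 3 := by
        have : ((k : ℝ) + 1) ≤ 12 / 11 * k := by linarith
        calc ((k : ℝ) + 1) ^ 3 ≤ (12 / 11 * k) ^ 3 := by gcongr
          _ = (12 / 11) ^ 3 * (k : ℝ) ^ 3 := by ring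
          _ ≤ 2.7 * (k : ℝ) ^ 3 := by gcongr; norm_num
      linarith
  refine h.trans ?_
  rw [← Real.exp_one_pow]
  gcongr
  linarith [Real.exp_one_gt_d9]

lemma wsum (n : ℕ) (S : Finset ℕ) :
    ∑ j ∈ S, (if j < 2 * n + 1 then 2 * n ^ 2 else 1)
      = 2 * n ^ 2 * (S.filter (fun j => j < 2 * n + 1)).card
        + (S.filter (fun j => ¬ j < 2 * n + 1)).card := by
  rw [Finset.sum_ite, Finset.sum_const, Finset.sum_const]
  simp [mul_comm]

lemma small_bound (n : ℕ) (hn : 11 ≤ n) (i : ℕ) (hi : 2 * n + 1 ≤ i)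
    (hi2 : i < 2 * n + 1 + 2 * n ^ 3) :
    (swingCount (3 * n ^ 3 + n ^ 2) (fun i => if i < 2 * n + 1 then 2 * n ^ 2 else 1)
      (Finset.range (2 * n + 1 + 2 * n ^ 3)) i : ℝ)
      ≤ 2 * 4 ^ n * (2 ^ (2 * n ^ 3) * Real.exp (-n + 1 / n)) := by
  have hn' : (11 : ℝ) ≤ n := by exact_mod_cast hn
  set A := (Finset.Ico (2 * n + 1) (2 * n + 1 + 2 * n ^ 3)).erase i with hA
  have hAc : A.card = 2 * n ^ 3 - 1 := by
    rw [hA, Finset.card_erase_of_mem (by simp; omega)]; simp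
  have hpos : 1 ≤ 2 * n ^ 3 := by have : 0 < n ^ 3 := by positivity
                                  omega
  have hAr : (A.card : ℝ) = 2 * (n : ℝ) ^ 3 - 1 := by
    rw [hAc]; push_cast [Nat.cast_sub hpos]; ring
  set d : ℝ := 2 * (n : ℝ) ^ 2 - 1 with hd
  have key : swingCount (3 * n ^ 3 + n ^ 2) (fun i => if i < 2 * n + 1 then 2 * n ^ 2 else 1)
      (Finset.range (2 * n + 1 + 2 * n ^ 3)) i ≤
      ((Finset.range (2 * n + 1)).powerset ×ˢ
        ((A.powerset).filter (fun B => d ≤ |2 * (B.card : ℝ) - A.card|))).card := by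
    unfold swingCount
    apply Finset.card_le_card_of_injOn
      (fun S => (S.filter (fun j => j < 2 * n + 1), S.filter (fun j => ¬ j < 2 * n + 1)))
    · intro S hS
      simp only [Finset.coe_filter, Set.mem_setOf_eq, Finset.mem_powerset] at hS
      obtain ⟨hS1, hS2, hS3⟩ := hS
      simp only [Finset.mem_coe, Finset.mem_product, Finset.mem_powerset, Finset.mem_filter]
      refine ⟨?_, ?_, ?_⟩
      · intro j hj; simp at hj ⊢; omega
      · intro j hj
        simp only [Finset.mem_filter] at hj
        have := hS1 hj.1
        simp [hA] at this ⊢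
        omega
      · rw [wsum] at hS2 hS3
        rw [if_neg (by omega)] at hS3
        set k := (S.filter (fun j => j < 2 * n + 1)).card
        set s := (S.filter (fun j => ¬ j < 2 * n + 1)).card
        have he : 2 * n ^ 2 * k + s + 1 = 3 * n ^ 3 + n ^ 2 := by omega
        have he' : 2 * (n : ℝ) ^ 2 * k + s + 1 = 3 * (n : ℝ) ^ 3 + (n : ℝ) ^ 2 := by
          exact_mod_cast he
        rw [hAr, hd, le_abs]
        rcases le_or_gt k n with h | h
        · left
          have h' : (k : ℝ) ≤ n := by exact_mod_cast h
          have := mul_le_mul_of_nonneg_left h' (by positivity : 0 ≤ 2 * (n : ℝ) ^ 2)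
          nlinarith
        · right
          have h' : (n : ℝ) + 1 ≤ k := by exact_mod_cast h
          have := mul_le_mul_of_nonneg_left h' (by positivity : 0 ≤ 2 * (n : ℝ) ^ 2)
          nlinarith
    · intro S _ T _ h
      simp only [Prod.mk.injEq] at h
      rw [← Finset.filter_union_filter_not_eq (fun j => j < 2 * n + 1) S, h.1, h.2,
        Finset.filter_union_filter_not_eq]
  have tb := tail_bound A (1 / n) d (by positivity)
  rw [Finset.card_product, Finset.card_powerset, Finset.card_range] at key
  have key' : (swingCount (3 * n ^ 3 + n ^ 2) (fun i => if i < 2 * n + 1 then 2 * n ^ 2 else 1)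
      (Finset.range (2 * n + 1 + 2 * n ^ 3)) i : ℝ) ≤ 2 ^ (2 * n + 1) *
      (((A.powerset).filter (fun B => d ≤ |2 * (B.card : ℝ) - A.card|)).card : ℝ) := by
    exact_mod_cast key
  refine key'.trans ?_
  have e1 : (2 : ℝ) ^ (2 * n + 1) = 2 * 4 ^ n := by
    rw [pow_succ, pow_mul]; norm_num; ring
  rw [e1]
  apply mul_le_mul_of_nonneg_left _ (by positivity)
  refine tb.trans ?_
  have e2 : (2 : ℝ) * 2 ^ A.card = 2 ^ (2 * n ^ 3) := by
    rw [← pow_succ', hAc]; congr 1; omega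
  rw [e2]
  apply mul_le_mul_of_nonneg_left _ (by positivity)
  rw [Real.exp_le_exp, hAr, hd]
  have : (2 * (n : ℝ) ^ 3 - 1) * (1 / n) ^ 2 / 2 - 1 / n * (2 * (n : ℝ) ^ 2 - 1)
      = -n + 1 / n - (1 / n) ^ 2 / 2 := by
    field_simp; ring
  rw [this]
  have : (0 : ℝ) ≤ (1 / n) ^ 2 / 2 := by positivity
  linarith

lemma large_bound (n : ℕ) (hn : 11 ≤ n) (i : ℕ) (hi : i < 2 * n + 1) :
    (n.centralBinom : ℝ) * (2 ^ (2 * n ^ 3) * (1 - 2 * Real.exp (-n))) ≤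
    (swingCount (3 * n ^ 3 + n ^ 2) (fun i => if i < 2 * n + 1 then 2 * n ^ 2 else 1)
      (Finset.range (2 * n + 1 + 2 * n ^ 3)) i : ℝ) := by
  have hn' : (11 : ℝ) ≤ n := by exact_mod_cast hn
  set A := Finset.Ico (2 * n + 1) (2 * n + 1 + 2 * n ^ 3) with hA
  have hAc : A.card = 2 * n ^ 3 := by simp [hA]
  have hAr : (A.card : ℝ) = 2 * (n : ℝ) ^ 3 := by rw [hAc]; push_cast; ring
  set d : ℝ := 2 * (n : ℝ) ^ 2 with hd
  set L := (Finset.range (2 * n + 1)).erase i with hL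
  have hLc : L.card = 2 * n := by
    rw [hL, Finset.card_erase_of_mem (by simpa using hi)]; simp
  have key : (Finset.powersetCard n L ×ˢ
        ((A.powerset).filter (fun B => ¬ d ≤ |2 * (B.card : ℝ) - A.card|))).card ≤
      swingCount (3 * n ^ 3 + n ^ 2) (fun i => if i < 2 * n + 1 then 2 * n ^ 2 else 1)
      (Finset.range (2 * n + 1 + 2 * n ^ 3)) i := by
    unfold swingCount
    have split : ∀ X Y : Finset ℕ, X ⊆ L → Y ⊆ A →
        (X ∪ Y).filter (fun j => j < 2 * n + 1) = X ∧
        (X ∪ Y).filter (fun j => ¬ j < 2 * n + 1) = Y := by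
      intro X Y hX hY
      constructor
      · ext j
        have h1 := @hX j
        have h2 := @hY j
        simp [hL, hA] at h1 h2 ⊢
        grind
      · ext j
        have h1 := @hX j
        have h2 := @hY j
        simp [hL, hA] at h1 h2 ⊢
        grind
    apply Finset.card_le_card_of_injOn (fun p => p.1 ∪ p.2)
    · rintro ⟨X, Y⟩ h
      simp only [Finset.mem_coe, Finset.mem_product, Finset.mem_powersetCard,
        Finset.mem_powerset, Finset.mem_filter] at h ⊢
      obtain ⟨⟨hX, hXc⟩, hY, hYc⟩ := h
      obtain ⟨s1, s2⟩ := split X Y hX hY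
      rw [wsum, s1, s2, hXc, if_pos hi]
      rw [not_le, abs_lt, hAr, hd] at hYc
      have a1 : n ^ 3 < Y.card + n ^ 2 := by
        have : (n : ℝ) ^ 3 < Y.card + (n : ℝ) ^ 2 := by linarith [hYc.1]
        exact_mod_cast this
      have a2 : Y.card < n ^ 3 + n ^ 2 := by
        have : (Y.card : ℝ) < (n : ℝ) ^ 3 + (n : ℝ) ^ 2 := by linarith [hYc.2]
        exact_mod_cast this
      have a3 : 2 * n ^ 2 * n = 2 * n ^ 3 := by ring
      refine ⟨?_, by omega, by omega⟩
      intro j hj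
      have h1 := @hX j
      have h2 := @hY j
      simp [hL, hA] at h1 h2 hj ⊢
      rcases hj with hj | hj
      · have := h1 hj; omega
      · have := h2 hj; omega
    · rintro ⟨X, Y⟩ h ⟨X', Y'⟩ h' e
      simp only [Finset.mem_coe, Finset.mem_product, Finset.mem_powersetCard,
        Finset.mem_powerset, Finset.mem_filter] at h h' e
      obtain ⟨s1, s2⟩ := split X Y h.1.1 h.2.1
      obtain ⟨s1', s2'⟩ := split X' Y' h'.1.1 h'.2.1
      rw [e] at s1 s2
      rw [← s1, ← s2, s1', s2']
  have tb := tail_bound A (1 / n) d (by positivity)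
  rw [Finset.card_product, Finset.card_powersetCard, hLc, ← Nat.centralBinom_eq_two_mul_choose]
    at key
  have cmpl := Finset.card_filter_add_card_filter_not (s := A.powerset)
    (fun B => d ≤ |2 * (B.card : ℝ) - A.card|)
  rw [Finset.card_powerset] at cmpl
  have cmpl' : (((A.powerset).filter (fun B => d ≤ |2 * (B.card : ℝ) - A.card|)).card : ℝ) +
      (((A.powerset).filter (fun B => ¬ d ≤ |2 * (B.card : ℝ) - A.card|)).card : ℝ)
      = 2 ^ A.card := by exact_mod_cast cmpl
  have key' : (n.centralBinom : ℝ) *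
      (((A.powerset).filter (fun B => ¬ d ≤ |2 * (B.card : ℝ) - A.card|)).card : ℝ) ≤ 
      (swingCount (3 * n ^ 3 + n ^ 2) (fun i => if i < 2 * n + 1 then 2 * n ^ 2 else 1)
      (Finset.range (2 * n + 1 + 2 * n ^ 3)) i : ℝ) := by
    exact_mod_cast key
  refine le_trans ?_ key'
  apply mul_le_mul_of_nonneg_left _ (by positivity)
  have : (A.card : ℝ) * (1 / n) ^ 2 / 2 - 1 / n * d = -n := by
    rw [hAr, hd]; field_simp; ring
  rw [this] at tb
  rw [← hAc]
  linarith

theorem stmt18 (n : ℕ) (hn : 11 ≤ n)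
    (wt : ℕ → ℕ) (hwt : wt = fun i => if i < 2 * n + 1 then 2 * n ^ 2 else 1)
    (P : Finset ℕ) (hP : P = Finset.range (2 * n + 1 + 2 * n ^ 3))
    (BZI : ℕ → ℝ)
    (hBZI : BZI = fun i => (swingCount (3 * n ^ 3 + n ^ 2) wt P i : ℝ) /
      (∑ j ∈ P, (swingCount (3 * n ^ 3 + n ^ 2) wt P j : ℝ)))
    (w : ℕ → ℝ)
    (hw : w = fun i => (wt i : ℝ) / (6 * (n : ℝ) ^ 3 + 2 * (n : ℝ) ^ 2)) :
    1 / 5 ≤ ∑ i ∈ P, |BZI i - w i| := by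
  have hn' : (11 : ℝ) ≤ n := by exact_mod_cast hn
  set η : ℕ → ℝ := fun i => (swingCount (3 * n ^ 3 + n ^ 2) wt P i : ℝ) with hη
  have hl : ∀ i ∈ Finset.range (2 * n + 1), (n.centralBinom : ℝ) *
      (2 ^ (2 * n ^ 3) * (1 - 2 * Real.exp (-n))) ≤ η i := by
    intro i hi
    have := large_bound n hn i (by simpa using hi)
    rw [hη, hwt, hP]; exact this
  have hs : ∀ i ∈ Finset.Ico (2 * n + 1) (2 * n + 1 + 2 * n ^ 3), η i ≤
      2 * 4 ^ n * (2 ^ (2 * n ^ 3) * Real.exp (-n + 1 / n)) := by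
    intro i hi
    rw [Finset.mem_Ico] at hi
    have := small_bound n hn i hi.1 hi.2
    rw [hη, hwt, hP]; exact this
  have hsplit : ∀ f : ℕ → ℝ, ∑ i ∈ P, f i = ∑ i ∈ Finset.range (2 * n + 1), f i +
      ∑ i ∈ Finset.Ico (2 * n + 1) (2 * n + 1 + 2 * n ^ 3), f i := by
    intro f
    rw [hP, Finset.sum_range_add_sum_Ico _ (by omega)]
  set TL := ∑ i ∈ Finset.range (2 * n + 1), η i with hTL
  set TS := ∑ i ∈ Finset.Ico (2 * n + 1) (2 * n + 1 + 2 * n ^ 3), η i with hTS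
  have hT : ∑ i ∈ P, η i = TL + TS := hsplit η
  set E := Real.exp (-(n : ℝ)) with hE
  have hEpos : 0 < E := Real.exp_pos _
  have hEn : 18 * (n : ℝ) ^ 3 * E ≤ 1 := by
    calc 18 * (n : ℝ) ^ 3 * E ≤ Real.exp n * E :=
          mul_le_mul_of_nonneg_right (num_bound n hn) hEpos.le
      _ = 1 := by rw [hE, ← Real.exp_add]; simp
  have hn3 : (1331 : ℝ) ≤ (n : ℝ) ^ 3 := by
    calc (1331 : ℝ) = 11 ^ 3 := by norm_num
      _ ≤ (n : ℝ) ^ 3 := by gcongr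
  have hexp : Real.exp (-n + 1 / n) ≤ 1.1 * E := by
    rw [Real.exp_add, mul_comm]
    apply mul_le_mul_of_nonneg_right _ hEpos.le
    have h1 := Real.one_sub_le_exp_neg (1 / (n : ℝ))
    have h2 : (1 : ℝ) / n ≤ 1 / 11 := by gcongr
    have h3 : Real.exp (1 / n) * Real.exp (-(1 / n)) = 1 := by rw [← Real.exp_add]; simp
    have h4 := Real.exp_pos (1 / (n : ℝ))
    nlinarith
  set M : ℝ := 4 ^ n * 2 ^ (2 * n ^ 3) with hM
  have hMpos : 0 < M := by positivity
  have h2E : 0 ≤ 1 - 2 * E := by nlinarith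
  have hTLb : M * (1 - 2 * E) ≤ TL := by
    have h := Finset.card_nsmul_le_sum _ _ _ hl
    rw [Finset.card_range, nsmul_eq_mul] at h
    refine le_trans ?_ h
    have hc : (4 : ℝ) ^ n ≤ 2 * n * n.centralBinom := by
      exact_mod_cast Nat.four_pow_le_two_mul_self_mul_centralBinom n (by omega)
    have hc2 : (4 : ℝ) ^ n ≤ (2 * n + 1) * n.centralBinom := by
      have : (0 : ℝ) ≤ n.centralBinom := by positivity
      linarith
    have := mul_le_mul_of_nonneg_right hc2
      (by positivity : (0 : ℝ) ≤ 2 ^ (2 * n ^ 3) * (1 - 2 * E))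
    push_cast
    rw [hM]
    linarith
  have hTSb : TS ≤ M * (4.4 * (n : ℝ) ^ 3 * E) := by
    have h := Finset.sum_le_card_nsmul _ _ _ hs
    rw [Nat.card_Ico, Nat.add_sub_cancel_left, nsmul_eq_mul] at h
    refine h.trans ?_
    push_cast
    have := mul_le_mul_of_nonneg_left hexp
      (by positivity : (0 : ℝ) ≤ 2 * (n : ℝ) ^ 3 * (2 * 4 ^ n * 2 ^ (2 * n ^ 3)))
    rw [hM]
    linarith
  have h4 : 4 * TS ≤ TL := by
    have : 4 * (4.4 * (n : ℝ) ^ 3 * E) ≤ 1 - 2 * E := by nlinarith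
    have := mul_le_mul_of_nonneg_left this hMpos.le
    linarith
  have hTSn : 0 ≤ TS := Finset.sum_nonneg (fun i _ => Nat.cast_nonneg _)
  have hTLp : 0 < TL := by
    have : 0 < M * (1 - 2 * E) := mul_pos hMpos (by nlinarith)
    linarith
  have hT0 : 0 < TL + TS := by linarith
  have hBZ : ∀ i, BZI i = η i / (TL + TS) := by
    intro i; rw [hBZI, ← hT]
  have b1 : ∑ i ∈ Finset.range (2 * n + 1), BZI i = TL / (TL + TS) := by
    simp_rw [hBZ]; rw [← Finset.sum_div]
  have b2 : ∑ i ∈ Finset.Ico (2 * n + 1) (2 * n + 1 + 2 * n ^ 3), BZI i = TS / (TL + TS) := by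
    simp_rw [hBZ]; rw [← Finset.sum_div]
  have w1 : ∑ i ∈ Finset.range (2 * n + 1), w i = (2 * n + 1) / (3 * n + 1) := by
    have : ∀ i ∈ Finset.range (2 * n + 1), w i = 1 / (3 * n + 1) := by
      intro i hi
      rw [hw, hwt]
      simp only [if_pos (Finset.mem_range.1 hi)]
      push_cast
      field_simp
      ring
    rw [Finset.sum_congr rfl this, Finset.sum_const, nsmul_eq_mul, Finset.card_range]
    push_cast; ring
  have w2 : ∑ i ∈ Finset.Ico (2 * n + 1) (2 * n + 1 + 2 * n ^ 3), w i = n / (3 * n + 1) := by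
    have : ∀ i ∈ Finset.Ico (2 * n + 1) (2 * n + 1 + 2 * n ^ 3),
        w i = 1 / (6 * (n : ℝ) ^ 3 + 2 * (n : ℝ) ^ 2) := by
      intro i hi
      rw [hw, hwt]
      simp only [if_neg (not_lt.2 (Finset.mem_Ico.1 hi).1)]
      push_cast
      rfl
    rw [Finset.sum_congr rfl this, Finset.sum_const, nsmul_eq_mul, Nat.card_Ico,
      Nat.add_sub_cancel_left]
    push_cast
    field_simp
    ring
  rw [hsplit]
  have l1 : ∑ i ∈ Finset.range (2 * n + 1), (BZI i - w i) ≤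
      ∑ i ∈ Finset.range (2 * n + 1), |BZI i - w i| :=
    Finset.sum_le_sum (fun i _ => le_abs_self _)
  have l2 : ∑ i ∈ Finset.Ico (2 * n + 1) (2 * n + 1 + 2 * n ^ 3), (w i - BZI i) ≤
      ∑ i ∈ Finset.Ico (2 * n + 1) (2 * n + 1 + 2 * n ^ 3), |BZI i - w i| :=
    Finset.sum_le_sum (fun i _ => by rw [abs_sub_comm]; exact le_abs_self _)
  rw [Finset.sum_sub_distrib, b1, w1] at l1
  rw [Finset.sum_sub_distrib, b2, w2] at l2
  have f1 : 4 / 5 ≤ TL / (TL + TS) := by rw [le_div_iff₀ hT0]; linarith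
  have f2 : TS / (TL + TS) ≤ 1 / 5 := by rw [div_le_iff₀ hT0]; linarith
  have f3 : (2 * (n : ℝ) + 1) / (3 * n + 1) - n / (3 * n + 1) ≤ 2 / 5 := by
    rw [← sub_div, div_le_iff₀ (by positivity)]; linarith
  linarith
end
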